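/- arXiv:1005.4897 — 3 statements merged into one kernel-verified Lean document; each statement's English description precedes it below -/
import Mathlib

section
/- Let G be a finite group and let f : G → {−1, 1} (values in ℝ) be a class function (f(x⁻¹yx) = f(y) for all x, y ∈ G) satisfying Σ_{x∈G} f(x) = 0. Suppose d is a positive natural number such that every nontrivial complex irreducible finite-dimensional representation of G has dimension at least d. Then the number of pairs (x, y) ∈ G × G with f(x·y) = f(x)·f(y) is at most (1/2)·(1 + 1/d)·|G|². -/
open scoped BigOperators

namespace ParityAux

open Module

lemma char_inv {G : Type} [Group G] {V : Type} [NormedAddCommGroup V] [InnerProductSpace ℂ V]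
    [FiniteDimensional ℂ V] (ρ : Representation ℂ G V)
    (hu : ∀ g u v, inner ℂ (ρ g u) (ρ g v) = inner ℂ u v) (g : G) :
    ρ.character g⁻¹ = (starRingEnd ℂ) (ρ.character g) := by
  unfold Representation.character
  rw [LinearMap.trace_eq_sum_inner _ (stdOrthonormalBasis ℂ V),
    LinearMap.trace_eq_sum_inner _ (stdOrthonormalBasis ℂ V), map_sum]
  refine Finset.sum_congr rfl fun i _ => ?_
  rw [inner_conj_symm, ← hu g]
  congr 1
  rw [← Module.End.mul_apply, ← map_mul]
  simp

lemma sum_char_bound {G : Type} [Group G] [Fintype G] (f : G → ℝ)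
    (hf : ∀ x, f x = 1 ∨ f x = -1) {V : Type} [NormedAddCommGroup V] [InnerProductSpace ℂ V]
    [FiniteDimensional ℂ V] (ρ : Representation ℂ G V) (hirr : ρ.IsIrreducible)
    (hu : ∀ g u v, inner ℂ (ρ g u) (ρ g v) = inner ℂ u v) :
    ‖∑ g, (f g : ℂ) * ρ.character g‖ ≤ Fintype.card G := by
  classical
  have hn : (0 : ℝ) < Fintype.card G := by exact_mod_cast Fintype.card_pos
  haveI : Invertible (Nat.card G : ℂ) := invertibleOfNonzero (by simp)
  have h1 : ∑ g, ‖ρ.character g‖ ^ 2 = (Fintype.card G : ℝ) := by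
    have h := Representation.char_orthonormal ρ ρ
    rw [if_pos ⟨Representation.Equiv.refl ρ⟩] at h
    have h2 : ∑ g : G, ρ.character g * ρ.character g⁻¹ = (Fintype.card G : ℂ) := by
      rw [inv_mul_eq_div, div_eq_iff (by simp)] at h
      simpa using h
    simp_rw [char_inv ρ hu, Complex.mul_conj'] at h2
    exact_mod_cast h2
  have h3 : ‖∑ g, (f g : ℂ) * ρ.character g‖ ≤ ∑ g, 1 * ‖ρ.character g‖ := by
    refine (norm_sum_le _ _).trans (le_of_eq (Finset.sum_congr rfl fun g _ => ?_))
    rcases hf g with h | h <;> simp [h]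
  have h4 := Finset.sum_mul_sq_le_sq_mul_sq Finset.univ (fun _ : G => (1 : ℝ))
    (fun g => ‖ρ.character g‖)
  rw [h1] at h4
  refine h3.trans (abs_le_of_sq_le_sq' ?_ hn.le).2
  refine h4.trans ?_
  simp [sq]

lemma eig_bound {G : Type} [Group G] [Fintype G] (f : G → ℝ)
    (hf : ∀ x, f x = 1 ∨ f x = -1)
    (hclass : ∀ x y : G, f (x⁻¹ * y * x) = f y)
    (hsum : ∑ x : G, f x = 0)
    (d : ℕ) (hd : 0 < d)
    (hrep : ∀ (V : Type) [AddCommGroup V] [Module ℂ V] [FiniteDimensional ℂ V]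
      (ρ : Representation ℂ G V),
      (∀ U : Submodule ℂ V, (∀ g : G, ∀ v ∈ U, ρ g v ∈ U) → U = ⊥ ∨ U = ⊤) →
      (∃ g : G, ρ g ≠ 1) → d ≤ Module.finrank ℂ V)
    {V : Type} [NormedAddCommGroup V] [InnerProductSpace ℂ V]
    [FiniteDimensional ℂ V] (ρ : Representation ℂ G V)
    (hu : ∀ g u v, inner ℂ (ρ g u) (ρ g v) = inner ℂ u v)
    (hcomm : ∀ g, Commute (∑ y, (f y : ℂ) • ρ y) (ρ g))
    (μ : ℂ) (hμ : Module.End.HasEigenvalue (∑ y, (f y : ℂ) • ρ y) μ) :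
    ‖μ‖ ≤ Fintype.card G / d := by
  set T : Module.End ℂ V := ∑ y, (f y : ℂ) • ρ y with hT
  let S : Set (Submodule ℂ V) := {U | U ≠ ⊥ ∧ (∀ v ∈ U, T v = μ • v) ∧
    ∀ g, ∀ v ∈ U, ρ g v ∈ U}
  have hS : S.Nonempty := by
    refine ⟨Module.End.eigenspace T μ, hμ, fun v hv => Module.End.mem_eigenspace_iff.1 hv, ?_⟩
    intro g v hv
    rw [Module.End.mem_eigenspace_iff] at hv ⊢
    have := LinearMap.congr_fun (hcomm g).eq v
    simp only [Module.End.mul_apply] at this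
    rw [this, hv, map_smul]
  obtain ⟨U, ⟨hU0, hUT, hUg⟩, hmin⟩ := WellFounded.has_min (wellFounded_lt) S hS
  let P : Subrepresentation ρ := ⟨U, fun g v hv => hUg g v hv⟩
  let σ : Representation ℂ G U := P.toRepresentation
  have hσ : ∀ g (v : U), ((σ g v : U) : V) = ρ g v := fun g v => rfl
  have key : ∀ X : Submodule ℂ U, (∀ g : G, ∀ v ∈ X, σ g v ∈ X) → X = ⊥ ∨ X = ⊤ := by
    intro X hX
    by_cases hb : X = ⊥
    · exact Or.inl hb
    right
    have hle : X.map U.subtype ≤ U := Submodule.map_subtype_le U X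
    have hmem : X.map U.subtype ∈ S := by
      refine ⟨?_, fun v hv => hUT v (hle hv), ?_⟩
      · intro h0
        apply hb
        apply Submodule.map_injective_of_injective U.injective_subtype
        rw [h0, Submodule.map_bot]
      · rintro g _ ⟨v, hv, rfl⟩
        exact ⟨σ g v, hX g v hv, rfl⟩
    have hEq : X.map U.subtype = U := by
      by_contra hne
      exact hmin _ hmem (lt_of_le_of_ne hle hne)
    rw [eq_top_iff]
    intro v _
    have hv : (v : V) ∈ X.map U.subtype := hEq.symm ▸ v.2
    obtain ⟨w, hw, hwv⟩ := hv
    have : w = v := Subtype.ext hwv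
    exact this ▸ hw
  have hnt : Nontrivial U := (Submodule.nontrivial_iff_ne_bot).2 hU0
  have hirr : σ.IsIrreducible := by
    haveI : Nontrivial (Subrepresentation σ) := by
      refine ⟨⊥, ⊤, fun h => ?_⟩
      have := congrArg Subrepresentation.toSubmodule h
      exact bot_ne_top (α := Submodule ℂ U) this
    refine ⟨fun X => ?_⟩
    rcases key X.toSubmodule (fun g v hv => X.apply_mem_toSubmodule g hv) with h | h
    · exact Or.inl (Subrepresentation.toSubmodule_injective h)
    · exact Or.inr (Subrepresentation.toSubmodule_injective h)
  have hTσ : ∑ y, (f y : ℂ) • σ y = μ • (1 : Module.End ℂ U) := by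
    ext v
    have := hUT v v.2
    simp only [hT, LinearMap.sum_apply, LinearMap.smul_apply] at this
    rw [LinearMap.sum_apply, AddSubmonoidClass.coe_finset_sum]
    exact this
  have hn : (0 : ℝ) < Fintype.card G := by exact_mod_cast Fintype.card_pos
  have hd' : (0 : ℝ) < d := by exact_mod_cast hd
  by_cases htriv : ∃ g, σ g ≠ 1
  · have hdim := hrep U σ key htriv
    have htr := congrArg (LinearMap.trace ℂ U) hTσ
    rw [map_sum] at htr
    simp only [map_smul, LinearMap.trace_one, smul_eq_mul] at htr
    have hb := sum_char_bound f hf σ hirr (fun g u v => hu g u v)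
    unfold Representation.character at hb
    rw [htr, norm_mul, Complex.norm_natCast] at hb
    rw [le_div_iff₀ hd']
    refine le_trans ?_ hb
    gcongr
  · push Not at htriv
    simp_rw [htriv, ← Finset.sum_smul] at hTσ
    rw [← Complex.ofReal_sum, hsum] at hTσ
    obtain ⟨v, hv⟩ := exists_ne (0 : U)
    have := LinearMap.congr_fun hTσ v
    have h0 : μ • v = 0 := by simpa using this.symm
    rw [(smul_eq_zero.1 h0).resolve_right hv, norm_zero]
    positivity

/-- Right translation on functions. -/
noncomputable def rt {G : Type} [Group G] [Fintype G] :
    Representation ℂ G (EuclideanSpace ℂ G) where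
  toFun g :=
    { toFun := fun h => WithLp.toLp 2 fun x => h (x * g)
      map_add' := fun _ _ => rfl
      map_smul' := fun _ _ => rfl }
  map_one' := by ext; simp
  map_mul' a b := by
    ext h x
    change h (x * (a * b)) = h (x * a * b)
    rw [mul_assoc]

lemma rt_apply {G : Type} [Group G] [Fintype G] (g : G) (h : EuclideanSpace ℂ G) (x : G) :
    rt g h x = h (x * g) := rfl

lemma rt_unitary {G : Type} [Group G] [Fintype G] (g : G) (u v : EuclideanSpace ℂ G) :
    inner ℂ (rt g u) (rt g v) = inner ℂ u v := by
  simp only [PiLp.inner_apply, rt_apply]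
  exact Fintype.sum_equiv (Equiv.mulRight g) _ _ fun x => rfl

lemma comm_aux {G : Type} [Group G] [Fintype G] (f : G → ℝ)
    (hclass : ∀ x y : G, f (x⁻¹ * y * x) = f y) {V : Type} [AddCommGroup V] [Module ℂ V]
    (ρ : Representation ℂ G V) (g : G) :
    Commute (∑ y, (f y : ℂ) • ρ y) (ρ g) := by
  unfold Commute SemiconjBy
  rw [Finset.sum_mul, Finset.mul_sum]
  refine Fintype.sum_equiv (MulAut.conj g⁻¹).toEquiv _ _ fun y => ?_
  simp only [MulEquiv.toEquiv_eq_coe, EquivLike.coe_coe, MulAut.conj_apply, inv_inv, hclass,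
    smul_mul_assoc, mul_smul_comm, ← map_mul]
  congr 2
  group

lemma op_bound {G : Type} [Group G] [Fintype G] (f : G → ℝ)
    (hf : ∀ x, f x = 1 ∨ f x = -1)
    (hclass : ∀ x y : G, f (x⁻¹ * y * x) = f y)
    (hsum : ∑ x : G, f x = 0)
    (d : ℕ) (hd : 0 < d)
    (hrep : ∀ (V : Type) [AddCommGroup V] [Module ℂ V] [FiniteDimensional ℂ V]
      (ρ : Representation ℂ G V),
      (∀ U : Submodule ℂ V, (∀ g : G, ∀ v ∈ U, ρ g v ∈ U) → U = ⊥ ∨ U = ⊤) →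
      (∃ g : G, ρ g ≠ 1) → d ≤ Module.finrank ℂ V)
    (h : EuclideanSpace ℂ G) :
    ‖(∑ y, (f y : ℂ) • rt y : Module.End ℂ (EuclideanSpace ℂ G)) h‖
      ≤ Fintype.card G / d * ‖h‖ := by
  set T : Module.End ℂ (EuclideanSpace ℂ G) := ∑ y, (f y : ℂ) • rt y with hT
  have hTg : ∀ g, Commute T (rt g) := comm_aux f hclass rt
  let T' : Module.End ℂ (EuclideanSpace ℂ G) := ∑ y, (f y : ℂ) • rt y⁻¹
  have hTT' : Commute T' T := by
    refine Commute.sum_left _ _ _ fun y _ => ?_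
    exact ((hTg y⁻¹).symm).smul_left _
  let A : EuclideanSpace ℂ G →L[ℂ] EuclideanSpace ℂ G := LinearMap.toContinuousLinearMap T
  let A' : EuclideanSpace ℂ G →L[ℂ] EuclideanSpace ℂ G := LinearMap.toContinuousLinearMap T'
  have hadj : star A = A' := by
    rw [ContinuousLinearMap.star_eq_adjoint, eq_comm, ContinuousLinearMap.eq_adjoint_iff]
    intro u v
    change inner ℂ (T' u) v = inner ℂ u (T v)
    simp only [T', hT, LinearMap.sum_apply, LinearMap.smul_apply, sum_inner, inner_sum,
      inner_smul_left, inner_smul_right, Complex.conj_ofReal]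
    refine Finset.sum_congr rfl fun y _ => ?_
    rw [← rt_unitary y, ← Module.End.mul_apply, ← map_mul]
    simp
  haveI : IsStarNormal A := by
    refine ⟨?_⟩
    rw [hadj]
    ext1 v
    exact LinearMap.congr_fun hTT'.eq v
  have hne : Nontrivial (EuclideanSpace ℂ G) := by
    infer_instance
  obtain ⟨μ, hμ, hμA⟩ := spectrum.exists_nnnorm_eq_spectralRadius A
  rw [IsStarNormal.spectralRadius_eq_nnnorm] at hμA
  have hμA' : ‖μ‖ = ‖A‖ := by
    have : ‖μ‖₊ = ‖A‖₊ := by exact_mod_cast hμA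
    exact congrArg NNReal.toReal this
  have heig : Module.End.HasEigenvalue T μ := by
    rw [Module.End.hasEigenvalue_iff_mem_spectrum]
    intro hun
    apply hμ
    change IsUnit _ at hun
    change IsUnit _
    obtain ⟨B, hB⟩ := hun
    refine ⟨⟨_, LinearMap.toContinuousLinearMap (B⁻¹ : (Module.End ℂ (EuclideanSpace ℂ G))ˣ).1,
      ?_, ?_⟩, rfl⟩
    · ext1 v
      have := LinearMap.congr_fun B.mul_inv v
      rw [hB] at this
      exact this
    · ext1 v
      have := LinearMap.congr_fun B.inv_mul v
      rw [hB] at this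
      exact this
  have hb := eig_bound f hf hclass hsum d hd hrep rt rt_unitary hTg μ heig
  refine (A.le_opNorm h).trans ?_
  rw [← hμA']
  gcongr

lemma triple_bound {G : Type} [Group G] [Fintype G] (f : G → ℝ)
    (hf : ∀ x, f x = 1 ∨ f x = -1)
    (hclass : ∀ x y : G, f (x⁻¹ * y * x) = f y)
    (hsum : ∑ x : G, f x = 0)
    (d : ℕ) (hd : 0 < d)
    (hrep : ∀ (V : Type) [AddCommGroup V] [Module ℂ V] [FiniteDimensional ℂ V]
      (ρ : Representation ℂ G V),
      (∀ U : Submodule ℂ V, (∀ g : G, ∀ v ∈ U, ρ g v ∈ U) → U = ⊥ ∨ U = ⊤) →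
      (∃ g : G, ρ g ≠ 1) → d ≤ Module.finrank ℂ V) :
    ∑ p : G × G, f (p.1 * p.2) * (f p.1 * f p.2) ≤ (Fintype.card G : ℝ) ^ 2 / d := by
  let F : EuclideanSpace ℂ G := WithLp.toLp 2 fun x => (f x : ℂ)
  have hF : ‖F‖ ^ 2 = Fintype.card G := by
    rw [EuclideanSpace.norm_sq_eq]
    have : ∀ x, ‖F x‖ ^ 2 = 1 := fun x => by
      change ‖(f x : ℂ)‖ ^ 2 = 1
      rcases hf x with h | h <;> simp [h]
    simp [this]
  have hb := op_bound f hf hclass hsum d hd hrep F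
  set T : Module.End ℂ (EuclideanSpace ℂ G) := ∑ y, (f y : ℂ) • rt y with hT
  have hin : inner ℂ F (T F) = ((∑ p : G × G, f (p.1 * p.2) * (f p.1 * f p.2) : ℝ) : ℂ) := by
    rw [hT, LinearMap.sum_apply, inner_sum, Fintype.sum_prod_type_right]
    push_cast
    refine Finset.sum_congr rfl fun y _ => ?_
    rw [LinearMap.smul_apply, inner_smul_right, PiLp.inner_apply, Finset.mul_sum]
    refine Finset.sum_congr rfl fun x _ => ?_
    rw [rt_apply]
    simp [F]
    ring
  have h1 := norm_inner_le_norm (𝕜 := ℂ) F (T F)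
  rw [hin, Complex.norm_real] at h1
  refine (le_abs_self _).trans (h1.trans ?_)
  calc ‖F‖ * ‖T F‖ ≤ ‖F‖ * (Fintype.card G / d * ‖F‖) := by gcongr
    _ = ‖F‖ ^ 2 * (Fintype.card G / d) := by ring
    _ = _ := by rw [hF]; ring

end ParityAux


theorem parity_upper_bound_class_function {G : Type} [Group G] [Fintype G] (f : G → ℝ)
    (hf : ∀ x, f x = 1 ∨ f x = -1)
    (hclass : ∀ x y : G, f (x⁻¹ * y * x) = f y)
    (hsum : ∑ x : G, f x = 0)
    (d : ℕ) (hd : 0 < d)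
    (hrep : ∀ (V : Type) [AddCommGroup V] [Module ℂ V] [FiniteDimensional ℂ V]
      (ρ : Representation ℂ G V),
      (∀ U : Submodule ℂ V, (∀ g : G, ∀ v ∈ U, ρ g v ∈ U) → U = ⊥ ∨ U = ⊤) →
      (∃ g : G, ρ g ≠ 1) → d ≤ Module.finrank ℂ V) :
    (Nat.card {p : G × G // f (p.1 * p.2) = f p.1 * f p.2} : ℝ) ≤
      (1 / 2) * (1 + 1 / (d : ℝ)) * (Fintype.card G : ℝ) ^ 2 := by
  classical
  have hb := ParityAux.triple_bound f hf hclass hsum d hd hrep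
  have hs : ∑ p : G × G, f (p.1 * p.2) * (f p.1 * f p.2) =
      2 * (Nat.card {p : G × G // f (p.1 * p.2) = f p.1 * f p.2} : ℝ)
        - (Fintype.card G : ℝ) ^ 2 := by
    have hp : ∀ p : G × G, f (p.1 * p.2) * (f p.1 * f p.2) =
        2 * (if f (p.1 * p.2) = f p.1 * f p.2 then (1 : ℝ) else 0) - 1 := by
      intro p
      rcases hf (p.1 * p.2) with h | h <;> rcases hf p.1 with h1 | h1 <;>
        rcases hf p.2 with h2 | h2 <;> rw [h, h1, h2] <;> norm_num
    rw [Finset.sum_congr rfl fun p _ => hp p, Finset.sum_sub_distrib, ← Finset.mul_sum,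
      Finset.sum_boole, Nat.card_eq_fintype_card, Fintype.card_subtype]
    simp [sq]
  rw [hs] at hb
  have : (1 / 2) * (1 + 1 / (d : ℝ)) * (Fintype.card G : ℝ) ^ 2 =
    ((Fintype.card G : ℝ) ^ 2 + (Fintype.card G : ℝ) ^ 2 / d) / 2 := by ring
  rw [this]
  linarith
end

section
/- For n ≥ 4, there exists a function f : A_n → {−1, 1} with Σ_{x∈A_n} f(x) = 0 such that the number of pairs (x, y) ∈ A_n × A_n with f(x·y) = f(x)·f(y) is at least (1/2)·(1 + 1/C(n,2))·|A_n|², where C(n,2) = n(n−1)/2. -/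
open scoped BigOperators

namespace AltParity

/-- Sign of `b - a`. -/
def sg {n : ℕ} (a b : Fin n) : ℤ := Int.sign ((b : ℤ) - a)

lemma sg_symm {n : ℕ} (a b : Fin n) : sg b a = - sg a b := by
  unfold sg
  rw [← Int.sign_neg]; congr 1; ring

lemma sg_self {n : ℕ} (a : Fin n) : sg a a = 0 := by simp [sg]

lemma sg_lt {n : ℕ} {a b : Fin n} (h : a < b) : sg a b = 1 := by
  unfold sg
  apply Int.sign_eq_one_of_pos
  have : (a : ℕ) < b := h
  omega

lemma sg_gt {n : ℕ} {a b : Fin n} (h : b < a) : sg a b = -1 := by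
  rw [sg_symm, sg_lt h]

lemma sg_or {n : ℕ} {a b : Fin n} (h : a ≠ b) : sg a b = 1 ∨ sg a b = -1 := by
  rcases lt_or_gt_of_ne h with h | h
  · exact Or.inl (sg_lt h)
  · exact Or.inr (sg_gt h)

lemma sg_triple {n : ℕ} {a b c : Fin n} (h1 : a ≠ b) (h2 : b ≠ c) (h3 : a ≠ c) :
    sg a c * (sg a b + sg b c) + sg b a * (sg b c + sg c a) + sg c b * (sg c a + sg a b) = 2 := by
  rcases lt_or_gt_of_ne h1 with h1 | h1 <;> rcases lt_or_gt_of_ne h2 with h2 | h2 <;>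
    rcases lt_or_gt_of_ne h3 with h3 | h3 <;>
    first
    | (exfalso; omega)
    | simp [sg_lt, sg_gt, h1, h2, h3]

/-- Correlation of the pair `(p,q)` with `(a,b)`. -/
def G {n : ℕ} (p q a b : Fin n) : ℤ :=
  ∑ x : alternatingGroup (Fin n), sg (x.1 p) (x.1 q) * sg (x.1 a) (x.1 b)

lemma G_symm {n : ℕ} (p q a b : Fin n) : G p q b a = - G p q a b := by
  unfold G
  rw [← Finset.sum_neg_distrib]
  refine Finset.sum_congr rfl fun x _ => ?_
  rw [sg_symm (x.1 a)]; ring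

lemma G_self {n : ℕ} (p q a : Fin n) : G p q a a = 0 := by simp [G, sg_self]

lemma G_pq {n : ℕ} {p q : Fin n} (h : p ≠ q) :
    G p q p q = Fintype.card (alternatingGroup (Fin n)) := by
  unfold G
  rw [Finset.sum_congr rfl (g := fun _ => (1 : ℤ))]
  · simp
  · intro x _
    rcases sg_or (x.1.injective.ne h) with h | h <;> rw [h] <;> norm_num

lemma G_ge {n : ℕ} {p q a b : Fin n} (h : p ≠ q) (h' : a ≠ b) :
    - (Fintype.card (alternatingGroup (Fin n)) : ℤ) ≤ G p q a b := by
  have : ∑ x : alternatingGroup (Fin n), (-1 : ℤ) ≤ G p q a b := by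
    unfold G
    refine Finset.sum_le_sum fun x _ => ?_
    rcases sg_or (x.1.injective.ne h) with h | h <;>
      rcases sg_or (x.1.injective.ne h') with h' | h' <;> rw [h, h'] <;> norm_num
  simpa using this

lemma sum_shift {n : ℕ} (z : Equiv.Perm (Fin n)) (hz : Equiv.Perm.sign z = 1)
    (F : Equiv.Perm (Fin n) → ℤ) :
    ∑ x : alternatingGroup (Fin n), F x.1 = ∑ x : alternatingGroup (Fin n), F (x.1 * z) := by
  symm
  exact Equiv.sum_comp (Equiv.mulRight (⟨z, hz⟩ : alternatingGroup (Fin n)))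
    (fun x : alternatingGroup (Fin n) => F x.1)

lemma G_shift {n : ℕ} (z : Equiv.Perm (Fin n)) (hz : Equiv.Perm.sign z = 1) (p q a b : Fin n) :
    G p q a b = G (z p) (z q) (z a) (z b) := by
  unfold G
  exact sum_shift z hz (fun x => sg (x p) (x q) * sg (x a) (x b))

lemma G_flip {n : ℕ} (p q a b : Fin n) : G q p a b = - G p q a b := by
  unfold G
  rw [← Finset.sum_neg_distrib]
  refine Finset.sum_congr rfl fun x _ => ?_
  rw [sg_symm (x.1 p)]; ring

lemma sign_two {n : ℕ} {a b c d : Fin n} (h : a ≠ b) (h' : c ≠ d) :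
    Equiv.Perm.sign (Equiv.swap a b * Equiv.swap c d) = 1 := by
  rw [Equiv.Perm.sign_mul, Equiv.Perm.sign_swap h, Equiv.Perm.sign_swap h']; rfl

lemma G_zero {n : ℕ} {p q a b c d : Fin n} (hpq : p ≠ q) (hcd : c ≠ d)
    (ha : a ≠ p ∧ a ≠ q ∧ a ≠ c ∧ a ≠ d) (hb : b ≠ p ∧ b ≠ q ∧ b ≠ c ∧ b ≠ d)
    (hc : c ≠ p ∧ c ≠ q) (hd : d ≠ p ∧ d ≠ q) : G p q a b = 0 := by
  have h := G_shift _ (sign_two hpq hcd) p q a b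
  simp only [Equiv.Perm.mul_apply] at h
  rw [Equiv.swap_apply_of_ne_of_ne hc.1.symm hd.1.symm,
    Equiv.swap_apply_of_ne_of_ne hc.2.symm hd.2.symm,
    Equiv.swap_apply_of_ne_of_ne ha.2.2.1 ha.2.2.2,
    Equiv.swap_apply_of_ne_of_ne hb.2.2.1 hb.2.2.2,
    Equiv.swap_apply_of_ne_of_ne ha.1 ha.2.1,
    Equiv.swap_apply_of_ne_of_ne hb.1 hb.2.1,
    Equiv.swap_apply_left, Equiv.swap_apply_right, G_flip p q] at h
  omega

lemma G_move {n : ℕ} {p q a b c : Fin n} (hpq : p ≠ q) (hac : a ≠ c)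
    (ha : a ≠ p ∧ a ≠ q) (hb : b ≠ p ∧ b ≠ q ∧ b ≠ a ∧ b ≠ c)
    (hc : c ≠ p ∧ c ≠ q) : G p q a b = - G p q c b := by
  have h := G_shift _ (sign_two hpq hac) p q a b
  simp only [Equiv.Perm.mul_apply] at h
  rw [Equiv.swap_apply_of_ne_of_ne ha.1.symm hc.1.symm,
    Equiv.swap_apply_of_ne_of_ne ha.2.symm hc.2.symm,
    Equiv.swap_apply_of_ne_of_ne hb.2.2.1 hb.2.2.2,
    Equiv.swap_apply_left a c,
    Equiv.swap_apply_of_ne_of_ne hc.1 hc.2,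
    Equiv.swap_apply_of_ne_of_ne hb.1 hb.2.1,
    Equiv.swap_apply_left, Equiv.swap_apply_right, G_flip p q] at h
  exact h

lemma G_third {n : ℕ} {p q b : Fin n} (hpq : p ≠ q) (hbp : b ≠ p) (hbq : b ≠ q) :
    3 * (G p q p b + G p q b q) = 2 * Fintype.card (alternatingGroup (Fin n)) := by
  set B : Equiv.Perm (Fin n) → ℤ :=
    fun x => sg (x p) (x q) * (sg (x p) (x b) + sg (x b) (x q)) with hB
  have h0 : G p q p b + G p q b q = ∑ x : alternatingGroup (Fin n), B x.1 := by
    simp only [G, hB, mul_add, Finset.sum_add_distrib]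
  set z : Equiv.Perm (Fin n) := Equiv.swap p b * Equiv.swap b q with hz
  have hs : Equiv.Perm.sign z = 1 := sign_two hbp.symm hbq
  have zp : z p = b := by
    rw [hz, Equiv.Perm.mul_apply, Equiv.swap_apply_of_ne_of_ne hbp.symm hpq,
      Equiv.swap_apply_left]
  have zb : z b = q := by
    rw [hz, Equiv.Perm.mul_apply, Equiv.swap_apply_left,
      Equiv.swap_apply_of_ne_of_ne hpq.symm hbq.symm]
  have zq : z q = p := by
    rw [hz, Equiv.Perm.mul_apply, Equiv.swap_apply_right, Equiv.swap_apply_right]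
  have h1 := sum_shift z hs B
  have h2 := sum_shift z hs (fun x => B (x * z))
  have h3 : ∑ x : alternatingGroup (Fin n), (B x.1 + B (x.1 * z) + B (x.1 * z * z))
      = ∑ x : alternatingGroup (Fin n), 2 := by
    refine Finset.sum_congr rfl fun x _ => ?_
    simp only [hB, Equiv.Perm.mul_apply, zp, zb, zq]
    exact sg_triple (x.1.injective.ne hbp.symm) (x.1.injective.ne hbq) (x.1.injective.ne hpq)
  rw [Finset.sum_add_distrib, Finset.sum_add_distrib] at h3
  simp only [Finset.sum_const, Finset.card_univ, nsmul_eq_mul] at h3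
  rw [h0]
  linarith

lemma main_big {n : ℕ} (hn : 6 ≤ n) (p q : Fin n) (hp : p.1 = 0) (hq : q.1 = n - 1) :
    2 * (Fintype.card (alternatingGroup (Fin n)) : ℤ) ≤ ∑ a, ∑ b, sg a b * G p q a b := by
  have hpq : p ≠ q := by intro h; have := congrArg Fin.val h; omega
  have lp : ∀ b, b ≠ p → p < b := by
    intro b hb
    have : b.1 ≠ p.1 := fun h => hb (Fin.ext h)
    exact Fin.lt_def.2 (by omega)
  have lq : ∀ b, b ≠ q → b < q := by
    intro b hb
    have : b.1 ≠ q.1 := fun h => hb (Fin.ext h)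
    exact Fin.lt_def.2 (by omega)
  set N : ℤ := (Fintype.card (alternatingGroup (Fin n)) : ℤ) with hN
  have hN0 : 0 ≤ N := by positivity
  have hmid : ∀ b, 0 ≤ G p q p b + G p q b q := by
    intro b
    by_cases h1 : b = p
    · rw [h1, G_self, G_pq hpq]; omega
    by_cases h2 : b = q
    · rw [h2, G_self, G_pq hpq]; omega
    have := G_third hpq h1 h2
    omega
  have hrp : ∑ b, sg p b * G p q p b = ∑ b, G p q p b := by
    refine Finset.sum_congr rfl fun b _ => ?_
    by_cases h : b = p
    · rw [h, G_self]; simp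
    · rw [sg_lt (lp b h), one_mul]
  have hrq : ∑ b, sg q b * G p q q b = ∑ b, G p q b q := by
    refine Finset.sum_congr rfl fun b _ => ?_
    by_cases h : b = q
    · rw [h, G_self]; simp
    · rw [sg_gt (lq b h), G_symm p q b q]; ring
  have hrow : ∀ a, a ≠ p → a ≠ q → 0 ≤ ∑ b, sg a b * G p q a b := by
    intro a h1 h2
    have hs : ∑ b ∈ ({p, q} : Finset (Fin n)), sg a b * G p q a b
        = ∑ b, sg a b * G p q a b := by
      refine Finset.sum_subset (Finset.subset_univ _) fun b _ hb => ?_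
      simp only [Finset.mem_insert, Finset.mem_singleton, not_or] at hb
      have hc : 1 < (({p, q, a, b} : Finset (Fin n))ᶜ).card := by
        have h4 : ({p, q, a, b} : Finset (Fin n)).card ≤ 4 := Finset.card_le_four
        rw [Finset.card_compl, Fintype.card_fin]
        omega
      obtain ⟨c, hc, d, hd, hcd⟩ := Finset.one_lt_card.1 hc
      simp only [Finset.mem_compl, Finset.mem_insert, Finset.mem_singleton, not_or] at hc hd
      rw [G_zero hpq hcd ⟨h1, h2, Ne.symm hc.2.2.1, Ne.symm hd.2.2.1⟩
        ⟨hb.1, hb.2, Ne.symm hc.2.2.2, Ne.symm hd.2.2.2⟩ ⟨hc.1, hc.2.1⟩ ⟨hd.1, hd.2.1⟩, mul_zero]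
    rw [← hs, Finset.sum_pair hpq, sg_gt (lp a h1), sg_lt (lq a h2), G_symm p q p a]
    have := hmid a
    linarith
  have hcol : 2 * N ≤ ∑ b, (G p q p b + G p q b q) := by
    have := Finset.sum_le_sum_of_subset_of_nonneg (Finset.subset_univ ({p, q} : Finset (Fin n)))
      (f := fun b => G p q p b + G p q b q) (fun b _ _ => hmid b)
    rw [Finset.sum_pair hpq] at this
    simp only [G_self, G_pq hpq] at this
    linarith
  have htot := Finset.sum_le_sum_of_subset_of_nonneg
    (Finset.subset_univ ({p, q} : Finset (Fin n)))
    (f := fun a => ∑ b, sg a b * G p q a b) (fun a _ ha => by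
      simp only [Finset.mem_insert, Finset.mem_singleton, not_or] at ha
      exact hrow a ha.1 ha.2)
  rw [Finset.sum_pair hpq] at htot
  simp only [hrp, hrq] at htot
  rw [Finset.sum_add_distrib] at hcol
  linarith

lemma main_four :
    2 * (Fintype.card (alternatingGroup (Fin 4)) : ℤ) ≤
      ∑ a : Fin 4, ∑ b, sg a b * G 0 3 a b := by
  have e1 := G_pq (p := (0 : Fin 4)) (q := 3) (by decide)
  have e2 := G_third (p := (0 : Fin 4)) (q := 3) (b := 1) (by decide) (by decide) (by decide)
  have e3 := G_third (p := (0 : Fin 4)) (q := 3) (b := 2) (by decide) (by decide) (by decide)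
  have e4 := G_ge (p := (0 : Fin 4)) (q := 3) (a := 1) (b := 2) (by decide) (by decide)
  have hs : ∑ a : Fin 4, ∑ b, sg a b * G 0 3 a b =
      2 * (G (n := 4) 0 3 0 1 + G (n := 4) 0 3 0 2 + G (n := 4) 0 3 0 3 + G (n := 4) 0 3 1 2 + G (n := 4) 0 3 1 3 + G (n := 4) 0 3 2 3) := by
    simp only [Fin.sum_univ_four]
    rw [G_symm 0 3 (0 : Fin 4) 1, G_symm 0 3 (0 : Fin 4) 2, G_symm 0 3 (0 : Fin 4) 3,
      G_symm 0 3 (1 : Fin 4) 2, G_symm 0 3 (1 : Fin 4) 3, G_symm 0 3 (2 : Fin 4) 3]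
    simp only [G_self]
    have s2 : Int.sign 2 = 1 := rfl
    have s3 : Int.sign 3 = 1 := rfl
    have s4 : Int.sign 4 = 1 := rfl
    simp [sg, s2, s3, s4]
    ring
  rw [hs]
  linarith

lemma main_five :
    2 * (Fintype.card (alternatingGroup (Fin 5)) : ℤ) ≤
      ∑ a : Fin 5, ∑ b, sg a b * G 0 4 a b := by
  have e1 := G_pq (p := (0 : Fin 5)) (q := 4) (by decide)
  have e2 := G_third (p := (0 : Fin 5)) (q := 4) (b := 1) (by decide) (by decide) (by decide)
  have e3 := G_third (p := (0 : Fin 5)) (q := 4) (b := 2) (by decide) (by decide) (by decide)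
  have e3' := G_third (p := (0 : Fin 5)) (q := 4) (b := 3) (by decide) (by decide) (by decide)
  have e4 := G_ge (p := (0 : Fin 5)) (q := 4) (a := 1) (b := 2) (by decide) (by decide)
  have e5 := G_move (p := (0 : Fin 5)) (q := 4) (a := 1) (b := 3) (c := 2)
    (by decide) (by decide) (by decide) (by decide) (by decide)
  have hs : ∑ a : Fin 5, ∑ b, sg a b * G 0 4 a b =
      2 * (G (n := 5) 0 4 0 1 + G (n := 5) 0 4 0 2 + G (n := 5) 0 4 0 3 + G (n := 5) 0 4 0 4 + G (n := 5) 0 4 1 2 + G (n := 5) 0 4 1 3 + G (n := 5) 0 4 1 4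
        + G (n := 5) 0 4 2 3 + G (n := 5) 0 4 2 4 + G (n := 5) 0 4 3 4) := by
    simp only [Fin.sum_univ_five]
    rw [G_symm 0 4 (0 : Fin 5) 1, G_symm 0 4 (0 : Fin 5) 2, G_symm 0 4 (0 : Fin 5) 3,
      G_symm 0 4 (0 : Fin 5) 4, G_symm 0 4 (1 : Fin 5) 2, G_symm 0 4 (1 : Fin 5) 3,
      G_symm 0 4 (1 : Fin 5) 4, G_symm 0 4 (2 : Fin 5) 3, G_symm 0 4 (2 : Fin 5) 4,
      G_symm 0 4 (3 : Fin 5) 4]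
    simp only [G_self]
    have s2 : Int.sign 2 = 1 := rfl
    have s3 : Int.sign 3 = 1 := rfl
    have s4 : Int.sign 4 = 1 := rfl
    simp [sg, s2, s3, s4]
    ring
  rw [hs]
  linarith

lemma main_all {n : ℕ} (hn : 4 ≤ n) (p q : Fin n) (hp : p.1 = 0) (hq : q.1 = n - 1) :
    2 * (Fintype.card (alternatingGroup (Fin n)) : ℤ) ≤ ∑ a, ∑ b, sg a b * G p q a b := by
  by_cases h : 6 ≤ n
  · exact main_big h p q hp hq
  have h45 : n = 4 ∨ n = 5 := by omega
  rcases h45 with rfl | rfl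
  · have h1 : p = 0 := Fin.ext hp
    have h2 : q = 3 := Fin.ext hq
    subst h1 h2
    exact main_four
  · have h1 : p = 0 := Fin.ext hp
    have h2 : q = 4 := Fin.ext hq
    subst h1 h2
    exact main_five

lemma two_trans {n : ℕ} (hn : 4 ≤ n) {p q a b : Fin n} (h : p ≠ q) (h' : a ≠ b) :
    ∃ z : Equiv.Perm (Fin n), Equiv.Perm.sign z = 1 ∧ z p = a ∧ z q = b := by
  have h0 := alternatingGroup.isMultiplyPretransitive (Fin n)
  rw [Nat.card_fin] at h0
  have h2 : MulAction.IsMultiplyPretransitive (alternatingGroup (Fin n)) (Fin n) 2 :=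
    MulAction.isMultiplyPretransitive_of_le (n := n - 2) (by omega) (by simp; try omega)
  rw [MulAction.is_two_pretransitive_iff] at h2
  obtain ⟨g, hg1, hg2⟩ := h2 h h'
  exact ⟨g.1, g.2, hg1, hg2⟩

lemma average {n : ℕ} (hn : 4 ≤ n) {p q : Fin n} (h : p ≠ q) (H : Fin n → Fin n → ℤ)
    (H0 : ∀ a, H a a = 0) :
    (n : ℤ) * (n - 1) * ∑ y : alternatingGroup (Fin n), H (y.1 p) (y.1 q) =
      Fintype.card (alternatingGroup (Fin n)) * ∑ a, ∑ b, H a b := by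
  have h1 : ∀ y : alternatingGroup (Fin n),
      ∑ a, ∑ b, H (y.1 a) (y.1 b) = ∑ a, ∑ b, H a b := by
    intro y
    rw [← Equiv.sum_comp y.1 (fun a => ∑ b, H a b)]
    refine Finset.sum_congr rfl fun a _ => ?_
    exact Equiv.sum_comp y.1 (fun b => H (y.1 a) b)
  have h2 : ∀ a b : Fin n, ∑ y : alternatingGroup (Fin n), H (y.1 a) (y.1 b) =
      if a = b then 0 else ∑ y : alternatingGroup (Fin n), H (y.1 p) (y.1 q) := by
    intro a b
    split_ifs with hab
    · subst hab; simp [H0]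
    · obtain ⟨z, hz, za, zb⟩ := two_trans hn h hab
      rw [sum_shift z hz (fun x => H (x p) (x q))]
      simp only [Equiv.Perm.mul_apply, za, zb]
  have h3 : ∑ y : alternatingGroup (Fin n), ∑ a, ∑ b, H (y.1 a) (y.1 b) =
      Fintype.card (alternatingGroup (Fin n)) * ∑ a, ∑ b, H a b := by
    simp only [h1, Finset.sum_const, Finset.card_univ, nsmul_eq_mul]
  rw [← h3, Finset.sum_comm]
  have h4 : ∀ a : Fin n, ∑ y : alternatingGroup (Fin n), ∑ b, H (y.1 a) (y.1 b) =
      (n - 1 : ℤ) * ∑ y : alternatingGroup (Fin n), H (y.1 p) (y.1 q) := by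
    intro a
    rw [Finset.sum_comm]
    rw [Finset.sum_congr rfl (fun b _ => h2 a b)]
    set S := ∑ y : alternatingGroup (Fin n), H (y.1 p) (y.1 q)
    have : ∀ b : Fin n, (if a = b then 0 else S) = S - if a = b then S else 0 := by
      intro b; split_ifs <;> simp
    simp only [this, Finset.sum_sub_distrib, Finset.sum_ite_eq, Finset.mem_univ, if_true,
      Finset.sum_const, Finset.card_univ, Fintype.card_fin, nsmul_eq_mul]
    ring
  simp only [h4, Finset.sum_const, Finset.card_univ, Fintype.card_fin, nsmul_eq_mul]
  ring

lemma triple_bound {n : ℕ} (hn : 4 ≤ n) (p q : Fin n) (hp : p.1 = 0) (hq : q.1 = n - 1) :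
    2 * (Fintype.card (alternatingGroup (Fin n)) : ℤ) ^ 2 ≤ (n : ℤ) * (n - 1) *
      ∑ x : alternatingGroup (Fin n), ∑ y : alternatingGroup (Fin n),
        sg (x.1 p) (x.1 q) * sg (y.1 p) (y.1 q) * sg ((x * y).1 p) ((x * y).1 q) := by
  have hpq : p ≠ q := by intro h; have := congrArg Fin.val h; omega
  have h := average hn hpq (fun a b => sg a b * G p q a b) (fun a => by simp [sg_self])
  have hm := main_all hn p q hp hq
  have he : ∑ y : alternatingGroup (Fin n), sg (y.1 p) (y.1 q) * G p q (y.1 p) (y.1 q) =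
      ∑ x : alternatingGroup (Fin n), ∑ y : alternatingGroup (Fin n),
        sg (x.1 p) (x.1 q) * sg (y.1 p) (y.1 q) * sg ((x * y).1 p) ((x * y).1 q) := by
    rw [Finset.sum_comm]
    refine Finset.sum_congr rfl fun y _ => ?_
    unfold G
    rw [Finset.mul_sum]
    refine Finset.sum_congr rfl fun x _ => ?_
    simp only [Subgroup.coe_mul, Equiv.Perm.mul_apply]
    ring
  rw [← he, h]
  nlinarith [hm, Int.natCast_nonneg (Fintype.card (alternatingGroup (Fin n)))]

lemma sum_zero {n : ℕ} {p q c d : Fin n} (hpq : p ≠ q) (hcd : c ≠ d)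
    (hc : c ≠ p ∧ c ≠ q) (hd : d ≠ p ∧ d ≠ q) :
    ∑ x : alternatingGroup (Fin n), sg (x.1 p) (x.1 q) = 0 := by
  have h := sum_shift _ (sign_two hpq hcd) (fun x => sg (x p) (x q))
  simp only [Equiv.Perm.mul_apply, Equiv.swap_apply_of_ne_of_ne hc.1.symm hd.1.symm,
    Equiv.swap_apply_of_ne_of_ne hc.2.symm hd.2.symm, Equiv.swap_apply_left,
    Equiv.swap_apply_right] at h
  have h' : ∑ x : alternatingGroup (Fin n), sg (x.1 q) (x.1 p) =
      - ∑ x : alternatingGroup (Fin n), sg (x.1 p) (x.1 q) := by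
    rw [← Finset.sum_neg_distrib]
    exact Finset.sum_congr rfl fun x _ => sg_symm _ _
  omega

end AltParity

open AltParity in
theorem alternating_parity_lower_bound (n : ℕ) (hn : 4 ≤ n) :
    ∃ f : alternatingGroup (Fin n) → ℝ,
      (∀ x, f x = 1 ∨ f x = -1) ∧ (∑ x : alternatingGroup (Fin n), f x = 0) ∧
      (1 / 2 : ℝ) * (1 + 1 / (n.choose 2 : ℝ)) *
          (Nat.card (alternatingGroup (Fin n)) : ℝ) ^ 2 ≤
        (Nat.card {p : alternatingGroup (Fin n) × alternatingGroup (Fin n) //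
            f (p.1 * p.2) = f p.1 * f p.2} : ℝ) := by
  classical
  set p : Fin n := ⟨0, by omega⟩ with hp
  set q : Fin n := ⟨n - 1, by omega⟩ with hq
  have hpq : p ≠ q := by intro h; have := congrArg Fin.val h; simp [hp, hq] at this; omega
  set f : alternatingGroup (Fin n) → ℝ := fun x => ((sg (x.1 p) (x.1 q) : ℤ) : ℝ) with hf
  have hf1 : ∀ x, f x = 1 ∨ f x = -1 := by
    intro x
    rcases sg_or (x.1.injective.ne hpq) with h | h
    · left; simp only [hf, h]; norm_num
    · right; simp only [hf, h]; norm_num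
  refine ⟨f, hf1, ?_, ?_⟩
  · have := sum_zero (p := p) (q := q) (c := ⟨1, by omega⟩) (d := ⟨2, by omega⟩) hpq
      (by simp) (by simp [hp, hq]; omega) (by simp [hp, hq]; omega)
    simp only [hf]
    exact_mod_cast this
  · have ht := triple_bound hn p q rfl rfl
    have ht' : 2 * (Fintype.card (alternatingGroup (Fin n)) : ℝ) ^ 2 ≤ (n : ℝ) * (n - 1) *
        ∑ x : alternatingGroup (Fin n), ∑ y : alternatingGroup (Fin n),
          f x * f y * f (x * y) := by
      simp only [hf]
      exact_mod_cast ht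
    have hcard : (Nat.card {p : alternatingGroup (Fin n) × alternatingGroup (Fin n) //
            f (p.1 * p.2) = f p.1 * f p.2} : ℝ) =
        (1 / 2) * ((Fintype.card (alternatingGroup (Fin n)) : ℝ) ^ 2 +
        ∑ x : alternatingGroup (Fin n), ∑ y : alternatingGroup (Fin n),
          f x * f y * f (x * y)) := by
      rw [Nat.card_eq_fintype_card, Fintype.card_subtype, Finset.card_filter]
      push_cast
      rw [Fintype.sum_prod_type]
      have hpt : ∀ x y : alternatingGroup (Fin n),
          (if f (x * y) = f x * f y then (1 : ℝ) else 0) =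
            (1 / 2) * (1 + f x * f y * f (x * y)) := by
        intro x y
        rcases hf1 x with h1 | h1 <;> rcases hf1 y with h2 | h2 <;>
          rcases hf1 (x * y) with h3 | h3 <;> rw [h1, h2, h3] <;> norm_num
      simp only [hpt, ← Finset.mul_sum, Finset.sum_add_distrib, Finset.sum_const,
        Finset.card_univ, nsmul_eq_mul]
      ring
    rw [hcard, Nat.card_eq_fintype_card, Nat.cast_choose_two]
    set N : ℝ := (Fintype.card (alternatingGroup (Fin n)) : ℝ)
    set T := ∑ x : alternatingGroup (Fin n), ∑ y : alternatingGroup (Fin n),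
          f x * f y * f (x * y)
    have hn' : (4 : ℝ) ≤ n := by exact_mod_cast hn
    have hpos : (0 : ℝ) < n * (n - 1) := by nlinarith
    have hT : 1 / ((n : ℝ) * (n - 1) / 2) * N ^ 2 ≤ T := by
      rw [one_div_div, div_mul_eq_mul_div, div_le_iff₀ hpos]
      linarith
    linarith
end

section
/- Let n ≥ 2 and suppose every nontrivial complex irreducible finite-dimensional representation of the alternating group A_n has dimension at least n−1. Then for every f : A_n → {−1, 1} with Σ_{x∈A_n} f(x) = 0, the number of pairs (x, y) ∈ A_n × A_n with f(x·y) = f(x)·f(y) is at most (1/2)·(1 + 1/√(n−1))·|A_n|². -/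
theorem exists_irr_dim {G : Type} [Group G] [Fintype G] (D : ℕ)
    (hrep : ∀ (V : Type) [AddCommGroup V] [Module ℂ V] [FiniteDimensional ℂ V]
      (ρ : Representation ℂ G V),
      (∀ U : Submodule ℂ V, (∀ g : G, ∀ v ∈ U, ρ g v ∈ U) → U = ⊥ ∨ U = ⊤) →
      (∃ g : G, ρ g ≠ 1) → D ≤ Module.finrank ℂ V)
    (E : Submodule ℂ (G → ℂ)) (hE : E ≠ ⊥)
    (hinv : ∀ g : G, ∀ v ∈ E, (fun x => v (g⁻¹ * x)) ∈ E)
    (hconst : ∀ v ∈ E, (∀ x, v x = v 1) → v = 0) : D ≤ Module.finrank ℂ E := by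
  classical
  let S : Set (Submodule ℂ (G → ℂ)) :=
    {W | W ≤ E ∧ W ≠ ⊥ ∧ ∀ g : G, ∀ v ∈ W, (fun x => v (g⁻¹ * x)) ∈ W}
  obtain ⟨W, ⟨hWE, hW0, hWinv⟩, hmin⟩ := WellFounded.has_min (r := ((· < ·) : Submodule ℂ (G → ℂ) → _ → Prop)) wellFounded_lt S ⟨E, le_rfl, hE, hinv⟩
  let L : Representation ℂ G (G → ℂ) :=
    { toFun := fun g => LinearMap.funLeft ℂ ℂ (fun x => g⁻¹ * x)
      map_one' := by ext; simp [LinearMap.funLeft_apply]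
      map_mul' := by
        intro a b
        refine LinearMap.ext fun v => funext fun x => ?_
        simp [LinearMap.funLeft_apply, mul_assoc] }
  have hL : ∀ g v, L g v = fun x => v (g⁻¹ * x) := fun g v => rfl
  have hLW : ∀ g, ∀ v ∈ W, L g v ∈ W := fun g v hv => hWinv g v hv
  let ρ : Representation ℂ G W :=
    { toFun := fun g => (L g).restrict (hLW g)
      map_one' := by ext; simp
      map_mul' := by
        intro a b
        refine LinearMap.ext fun v => Subtype.ext ?_
        simp }
  have hρ : ∀ g (v : W), ((ρ g v : W) : G → ℂ) = L g v := fun g v => rfl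
  refine (hrep W ρ ?_ ?_).trans (Submodule.finrank_mono hWE)
  · intro U hU
    by_contra! hcon
    obtain ⟨hb, ht⟩ := hcon
    refine hmin (U.map W.subtype) ⟨(Submodule.map_subtype_le _ _).trans hWE, ?_, ?_⟩ ?_
    · exact fun h => hb (Submodule.map_injective_of_injective W.injective_subtype (h.trans (Submodule.map_bot _).symm))
    · rintro g v ⟨u, hu, rfl⟩
      exact ⟨ρ g u, hU g u hu, rfl⟩
    · refine lt_of_le_of_ne (Submodule.map_subtype_le _ _) fun h => ht ?_
      rw [eq_top_iff]
      rintro ⟨v, hv⟩ -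
      rw [← h] at hv
      obtain ⟨u, hu, rfl⟩ := hv
      exact hu
  · by_contra! hcon
    obtain ⟨v, hv, hv0⟩ := Submodule.exists_mem_ne_zero_of_ne_bot hW0
    refine hv0 (hconst v (hWE hv) fun x => ?_)
    have := congrArg (fun w : W => (w : G → ℂ) x) (LinearMap.congr_fun (hcon x) ⟨v, hv⟩)
    simp only [hρ, hL] at this
    simpa using this.symm

open Matrix ComplexOrder in
theorem psd_mult {G : Type} [Fintype G] [DecidableEq G] (A : Matrix G G ℂ) (hA : A.PosSemidef)
    (l : ℝ) (hl : 0 ≤ l) :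
    (Module.finrank ℂ (Module.End.eigenspace (Matrix.toLin' A) (l : ℂ)) : ℝ) * l ≤ A.trace.re := by
  have h1 : Module.finrank ℂ (Module.End.eigenspace (Matrix.toLin' A) (l : ℂ)) ≤
      (Finset.univ.filter fun i => hA.1.eigenvalues i = l).card := by
    have h2 := LinearMap.finrank_maxGenEigenspace_eq (Matrix.toLin' A) (l : ℂ)
    have h3 : Module.finrank ℂ (Module.End.eigenspace (Matrix.toLin' A) (l : ℂ)) ≤
      Module.finrank ℂ (Module.End.maxGenEigenspace (Matrix.toLin' A) (l : ℂ)) := by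
      apply Submodule.finrank_mono
      exact Module.End.eigenspace_le_maxGenEigenspace
    rw [h2, Matrix.charpoly_toLin', ← Polynomial.count_roots, hA.1.roots_charpoly_eq_eigenvalues,
      Multiset.count_map] at h3
    refine h3.trans (le_of_eq ?_)
    rw [Finset.card_def, Finset.filter_val]
    congr 1
    apply Multiset.filter_congr
    intro x _
    simp [eq_comm]
  rw [hA.1.trace_eq_sum_eigenvalues]
  simp only [Complex.coe_algebraMap, Complex.re_sum, Complex.ofReal_re]
  calc _ ≤ ((Finset.univ.filter fun i => hA.1.eigenvalues i = l).card : ℝ) * l := by gcongr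
    _ = ∑ i ∈ Finset.univ.filter (fun i => hA.1.eigenvalues i = l), hA.1.eigenvalues i := by
      rw [Finset.sum_congr rfl (g := fun _ => l) (by simp)]; simp
    _ ≤ ∑ i, hA.1.eigenvalues i :=
      Finset.sum_le_sum_of_subset_of_nonneg (Finset.filter_subset _ _)
        fun i _ _ => hA.eigenvalues_nonneg i
    _ = _ := by simp

open Matrix ComplexOrder in
theorem psd_bound {G : Type} [Fintype G] [DecidableEq G] (A : Matrix G G ℂ) (hA : A.PosSemidef)
    (c : ℝ) (hc : 0 ≤ c)
    (h : ∀ l : ℝ, 0 < l → Module.End.eigenspace (Matrix.toLin' A) (l : ℂ) ≠ ⊥ → l ≤ c)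
    (v : G → ℂ) : (star v ⬝ᵥ A *ᵥ v).re ≤ c * (star v ⬝ᵥ v).re := by
  have hH : ((c : ℂ) • (1 : Matrix G G ℂ) - A).IsHermitian := by
    refine Matrix.IsHermitian.sub ?_ hA.1
    simp [Matrix.IsHermitian, conjTranspose_smul]
  have hP : ((c : ℂ) • (1 : Matrix G G ℂ) - A).PosSemidef := by
    rw [hH.posSemidef_iff_eigenvalues_nonneg]
    intro i
    by_contra hneg
    simp only [Pi.zero_apply, not_le] at hneg
    have he := hH.mulVec_eigenvectorBasis i
    have := h (c - hH.eigenvalues i) (by linarith) ?_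
    · linarith
    · rw [Submodule.ne_bot_iff]
      refine ⟨⇑(hH.eigenvectorBasis i), ?_, ?_⟩
      · rw [Module.End.mem_eigenspace_iff, Matrix.toLin'_apply]
        rw [sub_mulVec, smul_mulVec, one_mulVec] at he
        ext x
        have := congrFun he x
        simp at this ⊢
        linear_combination -this
      · intro h0
        have := hH.eigenvectorBasis.orthonormal.ne_zero i
        apply this
        ext x
        exact congrFun h0 x
  have := (Complex.le_def.1 (hP.dotProduct_mulVec_nonneg v)).1
  simp [sub_mulVec, smul_mulVec, dotProduct_sub] at this
  simpa using this

open Matrix ComplexOrder in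
theorem key_bound {G : Type} [Group G] [Fintype G] (D : ℕ) (hD : 0 < D)
    (hrep : ∀ (V : Type) [AddCommGroup V] [Module ℂ V] [FiniteDimensional ℂ V]
      (ρ : Representation ℂ G V),
      (∀ U : Submodule ℂ V, (∀ g : G, ∀ v ∈ U, ρ g v ∈ U) → U = ⊥ ∨ U = ⊤) →
      (∃ g : G, ρ g ≠ 1) → D ≤ Module.finrank ℂ V)
    (f : G → ℝ) (hf : ∀ x, f x ^ 2 = 1) (hs : ∑ x, f x = 0) :
    ∑ x, (∑ y, f (x⁻¹ * y) * f y) ^ 2 ≤ (Fintype.card G : ℝ) ^ 2 / D * Fintype.card G := by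
  classical
  have hD' : (0 : ℝ) < D := by exact_mod_cast hD
  let M : Matrix G G ℂ := Matrix.of fun x y => (f (x⁻¹ * y) : ℂ)
  have hM : ∀ x y, M x y = (f (x⁻¹ * y) : ℂ) := fun _ _ => rfl
  have hMH : ∀ x y, Mᴴ x y = (f (y⁻¹ * x) : ℂ) := fun _ _ => by
    simp [conjTranspose_apply, hM]
  have hP := posSemidef_conjTranspose_mul_self M
  have htr : (Mᴴ * M).trace.re = (Fintype.card G : ℝ) ^ 2 := by
    have : (Mᴴ * M).trace = (Fintype.card G : ℂ) ^ 2 := by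
      simp only [trace, diag_apply, mul_apply, hMH, hM, ← pow_two, ← Complex.ofReal_pow, hf]
      simp [pow_two]
    rw [this]; norm_cast
  have hA : ∀ g x y, (Mᴴ * M) (g * x) (g * y) = (Mᴴ * M) x y := by
    intro g x y
    simp only [mul_apply, hMH, hM]
    rw [← Equiv.sum_comp (Equiv.mulLeft g)]
    simp [mul_assoc]
  have key := psd_bound (Mᴴ * M) hP ((Fintype.card G : ℝ) ^ 2 / D) (by positivity) ?_
    (fun x => (f x : ℂ))
  · have e1 : star (fun x => (f x : ℂ)) ⬝ᵥ (Mᴴ * M) *ᵥ (fun x => (f x : ℂ)) =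
        ((∑ x, (∑ y, f (x⁻¹ * y) * f y) ^ 2 : ℝ) : ℂ) := by
      rw [← mulVec_mulVec, dotProduct_mulVec, ← star_mulVec]
      simp only [dotProduct, mulVec, hM, Pi.star_apply, star_sum, star_mul', Complex.star_def, Complex.conj_ofReal]
      push_cast
      simp [pow_two]
    have e2 : star (fun x => (f x : ℂ)) ⬝ᵥ (fun x => (f x : ℂ)) = ((Fintype.card G : ℝ) : ℂ) := by
      simp only [dotProduct, Pi.star_apply, Complex.star_def, Complex.conj_ofReal, ← pow_two,
        ← Complex.ofReal_pow, hf]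
      simp
    rw [e1, e2] at key
    simpa only [Complex.ofReal_re] using key
  · intro l hl hne
    have h1 := psd_mult (Mᴴ * M) hP l hl.le
    rw [htr] at h1
    have h2 : D ≤ Module.finrank ℂ (Module.End.eigenspace (Matrix.toLin' (Mᴴ * M)) (l : ℂ)) := by
      apply exists_irr_dim D hrep _ hne
      · intro g v hv
        rw [Module.End.mem_eigenspace_iff, Matrix.toLin'_apply] at hv ⊢
        ext x
        have := congrFun hv (g⁻¹ * x)
        simp only [mulVec, dotProduct, Pi.smul_apply] at this ⊢
        rw [← this, ← Equiv.sum_comp (Equiv.mulLeft g)]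
        refine Finset.sum_congr rfl fun y _ => ?_
        have := hA g (g⁻¹ * x) y
        rw [mul_inv_cancel_left] at this
        simp [this]
      · intro v hv hc
        rw [Module.End.mem_eigenspace_iff, Matrix.toLin'_apply, ← mulVec_mulVec] at hv
        have h0 : M *ᵥ v = 0 := by
          ext x
          simp only [mulVec, dotProduct, hM, Pi.zero_apply]
          rw [Finset.sum_congr rfl fun y _ => by rw [hc y], ← Finset.sum_mul,
            ← Equiv.sum_comp (Equiv.mulLeft x)]
          simp [← Complex.ofReal_sum, hs]
        rw [h0, mulVec_zero] at hv
        have hl' : (l : ℂ) ≠ 0 := by exact_mod_cast hl.ne'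
        exact (smul_eq_zero.1 hv.symm).resolve_left hl'
    rw [le_div_iff₀ hD']
    have : (D : ℝ) ≤ Module.finrank ℂ (Module.End.eigenspace (Matrix.toLin' (Mᴴ * M)) (l : ℂ)) := by
      exact_mod_cast h2
    nlinarith

theorem count_bound {G : Type} [Group G] [Fintype G] (D : ℕ) (hD : 0 < D)
    (hrep : ∀ (V : Type) [AddCommGroup V] [Module ℂ V] [FiniteDimensional ℂ V]
      (ρ : Representation ℂ G V),
      (∀ U : Submodule ℂ V, (∀ g : G, ∀ v ∈ U, ρ g v ∈ U) → U = ⊥ ∨ U = ⊤) →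
      (∃ g : G, ρ g ≠ 1) → D ≤ Module.finrank ℂ V)
    (f : G → ℝ) (hf : ∀ x, f x = 1 ∨ f x = -1) (hs : ∑ x, f x = 0) :
    (Nat.card {p : G × G // f (p.1 * p.2) = f p.1 * f p.2} : ℝ) ≤
      (1 / 2 : ℝ) * (1 + 1 / Real.sqrt D) * (Nat.card G : ℝ) ^ 2 := by
  classical
  have hD' : (0 : ℝ) < D := by exact_mod_cast hD
  have hf2 : ∀ x, f x ^ 2 = 1 := fun x => by rcases hf x with h | h <;> simp [h]
  have hk := key_bound D hD hrep f hf2 hs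
  set N : ℝ := (Fintype.card G : ℝ) with hN
  have hN0 : 0 ≤ N := by positivity
  have hcs := Finset.sum_mul_sq_le_sq_mul_sq Finset.univ f (fun x => ∑ y, f (x⁻¹ * y) * f y)
  have hfs : ∑ x, f x ^ 2 = N := by simp [hf2, hN]
  rw [hfs] at hcs
  have hS : ∑ x, f x * ∑ y, f (x⁻¹ * y) * f y = ∑ p : G × G, f (p.1 * p.2) * (f p.1 * f p.2) := by
    rw [Fintype.sum_prod_type]
    refine Finset.sum_congr rfl fun x _ => ?_
    rw [Finset.mul_sum, ← Equiv.sum_comp (Equiv.mulLeft x)]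
    refine Finset.sum_congr rfl fun y _ => ?_
    simp; ring
  rw [hS] at hcs
  set S := ∑ p : G × G, f (p.1 * p.2) * (f p.1 * f p.2) with hSdef
  have hSle : S ≤ N ^ 2 / Real.sqrt D := by
    refine (abs_le_of_sq_le_sq' ?_ (by positivity)).2
    rw [div_pow, Real.sq_sqrt hD'.le]
    calc S ^ 2 ≤ N * (N ^ 2 / D * N) := hcs.trans (by gcongr)
      _ = _ := by ring
  have hcard : (Nat.card {p : G × G // f (p.1 * p.2) = f p.1 * f p.2} : ℝ) = 1 / 2 * (N ^ 2 + S) := by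
    rw [Nat.card_eq_fintype_card, Fintype.card_subtype, Finset.card_filter]
    push_cast
    have : N ^ 2 = ∑ p : G × G, (1 : ℝ) := by simp [hN, pow_two]
    rw [this, hSdef, ← Finset.sum_add_distrib, Finset.mul_sum]
    refine Finset.sum_congr rfl fun p _ => ?_
    rcases hf (p.1 * p.2) with h | h <;> rcases hf p.1 with hc1 | hc1 <;>
      rcases hf p.2 with hc2 | hc2 <;> rw [h, hc1, hc2] <;> norm_num
  rw [hcard, Nat.card_eq_fintype_card]
  have : N ^ 2 / Real.sqrt D = 1 / Real.sqrt D * N ^ 2 := by ring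
  rw [this] at hSle
  nlinarith



open scoped BigOperators

theorem alternating_parity_upper_bound (n : ℕ) (hn : 2 ≤ n)
    (hrep : ∀ (V : Type) [AddCommGroup V] [Module ℂ V] [FiniteDimensional ℂ V]
      (ρ : Representation ℂ (alternatingGroup (Fin n)) V),
      (∀ U : Submodule ℂ V,
        (∀ g : alternatingGroup (Fin n), ∀ v ∈ U, ρ g v ∈ U) → U = ⊥ ∨ U = ⊤) →
      (∃ g : alternatingGroup (Fin n), ρ g ≠ 1) → n - 1 ≤ Module.finrank ℂ V) :
    ∀ f : alternatingGroup (Fin n) → ℝ,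
      (∀ x, f x = 1 ∨ f x = -1) → (∑ x : alternatingGroup (Fin n), f x = 0) →
      (Nat.card {p : alternatingGroup (Fin n) × alternatingGroup (Fin n) //
          f (p.1 * p.2) = f p.1 * f p.2} : ℝ) ≤
        (1 / 2 : ℝ) * (1 + 1 / Real.sqrt ((n : ℝ) - 1)) *
          (Nat.card (alternatingGroup (Fin n)) : ℝ) ^ 2 := by
  intro f hf hs
  have h := count_bound (n - 1) (by omega) hrep f hf hs
  rwa [Nat.cast_sub (by omega), Nat.cast_one] at h
end
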